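/- arXiv:1904.11300 — 3 statements merged into one kernel-verified Lean document; each statement's English description precedes it below -/
import Mathlib

section
/- Let A ∈ B(𝓗) be self-adjoint with spectrum contained in [δ,∞) for some δ > 0. Then for every x ∈ ℝ the operator x²·1 + A is invertible in B(𝓗), the map x ↦ A·(x²·1 + A)⁻¹ is Bochner integrable on (0,∞) (its operator norm is at most ‖A‖/(x² + δ)), and √A = (2/π) · ∫_{(0,∞)} A·(x²·1 + A)⁻¹ dx, the integral being a Bochner integral in the Banach space B(𝓗). -/
open MeasureTheory
set_option synthInstance.maxHeartbeats 1000000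
set_option maxHeartbeats 1000000

variable {𝓗 : Type*} [NormedAddCommGroup 𝓗] [InnerProductSpace ℂ 𝓗] [CompleteSpace 𝓗]

lemma aux_integral (t : ℝ) (ht : 0 < t) :
    ∫ x in Set.Ioi (0 : ℝ), t * (x ^ 2 + t)⁻¹ = Real.pi / 2 * √t := by
  have hs : 0 < √t := Real.sqrt_pos.mpr ht
  have h := integral_comp_mul_left_Ioi (fun x : ℝ => (1 + x ^ 2)⁻¹) 0 (inv_pos.mpr hs)
  rw [mul_zero, integral_Ioi_inv_one_add_sq, Real.arctan_zero, sub_zero, inv_inv, smul_eq_mul,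
    mul_comm] at h
  rw [← h]
  congr 1
  funext x
  rw [mul_pow, inv_pow, Real.sq_sqrt ht.le]
  have : x ^ 2 + t ≠ 0 := by positivity
  have : 1 + t⁻¹ * x ^ 2 ≠ 0 := by positivity
  field_simp
  ring

lemma aux_integrable (c t : ℝ) (ht : 0 < t) :
    Integrable (fun x : ℝ => c / (x ^ 2 + t)) := by
  have hs : 0 < √t := Real.sqrt_pos.mpr ht
  have h := (integrable_inv_one_add_sq.comp_mul_left' (inv_pos.mpr hs).ne').const_mul (c / t)
  refine h.congr (Filter.Eventually.of_forall fun x => ?_)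
  simp only
  rw [mul_pow, inv_pow, Real.sq_sqrt ht.le]
  have : x ^ 2 + t ≠ 0 := by positivity
  have : 1 + t⁻¹ * x ^ 2 ≠ 0 := by positivity
  field_simp
  ring

/-- Integral representation of the positive square root of a self-adjoint operator
`A` with spectrum in `[δ,∞)`, `δ > 0`:  for every `x ∈ ℝ` the operator `x²·1 + A` is
invertible, the map `x ↦ A·(x²·1 + A)⁻¹` is Bochner integrable on `(0,∞)` with
`‖A·(x²·1 + A)⁻¹‖ ≤ ‖A‖/(x² + δ)`, and `√A = (2/π) · ∫_{(0,∞)} A·(x²·1 + A)⁻¹ dx`. -/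
theorem stmt_1 (A : 𝓗 →L[ℂ] 𝓗) (hA : IsSelfAdjoint A) (δ : ℝ) (hδ : 0 < δ)
    (hspec : spectrum ℝ A ⊆ Set.Ici δ) :
    (∀ x : ℝ, IsUnit (x ^ 2 • (1 : 𝓗 →L[ℂ] 𝓗) + A)) ∧
    IntegrableOn (fun x : ℝ => A * Ring.inverse (x ^ 2 • (1 : 𝓗 →L[ℂ] 𝓗) + A))
      (Set.Ioi 0) ∧
    (∀ x : ℝ, ‖A * Ring.inverse (x ^ 2 • (1 : 𝓗 →L[ℂ] 𝓗) + A)‖ ≤ ‖A‖ / (x ^ 2 + δ)) ∧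
    CFC.sqrt A =
      (2 / Real.pi) • ∫ x in Set.Ioi (0 : ℝ),
        A * Ring.inverse (x ^ 2 • (1 : 𝓗 →L[ℂ] 𝓗) + A) := by
  have hpos : ∀ t ∈ spectrum ℝ A, 0 < t := fun t ht => hδ.trans_le (hspec ht)
  have hne : ∀ x : ℝ, ∀ t ∈ spectrum ℝ A, x ^ 2 + t ≠ 0 := fun x t ht => by
    have := hpos t ht
    positivity
  have hadd : ∀ x : ℝ, cfc (fun t : ℝ => x ^ 2 + t) A = x ^ 2 • (1 : 𝓗 →L[ℂ] 𝓗) + A := by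
    intro x
    rw [cfc_const_add (x ^ 2) (fun t : ℝ => t) A, cfc_id' ℝ A, Algebra.algebraMap_eq_smul_one]
  have hf : ∀ x : ℝ, A * Ring.inverse (x ^ 2 • (1 : 𝓗 →L[ℂ] 𝓗) + A) =
      cfc (fun t : ℝ => t * (x ^ 2 + t)⁻¹) A := by
    intro x
    have hc : ContinuousOn (fun t : ℝ => (x ^ 2 + t)⁻¹) (spectrum ℝ A) :=
      ContinuousOn.inv₀ (by fun_prop) (hne x)
    rw [cfc_mul (fun t : ℝ => t) (fun t : ℝ => (x ^ 2 + t)⁻¹) A (by fun_prop) hc, cfc_id' ℝ A,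
      cfc_inv (fun t : ℝ => x ^ 2 + t) A (hne x), hadd]
  have hle : ∀ t ∈ spectrum ℝ A, t ≤ ‖A‖ := by
    intro t ht
    have := norm_apply_le_norm_cfc (fun t : ℝ => t) A ht
    rw [cfc_id' ℝ A] at this
    exact (le_abs_self t).trans this
  have hbd : ∀ x : ℝ, ∀ t ∈ spectrum ℝ A, ‖t * (x ^ 2 + t)⁻¹‖ ≤ ‖A‖ / (x ^ 2 + δ) := by
    intro x t ht
    have h0 := hpos t ht
    have h1 : δ ≤ t := hspec ht
    rw [Real.norm_of_nonneg (by positivity), ← div_eq_mul_inv]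
    have := hle t ht
    gcongr
  have hcont : ContinuousOn (Function.uncurry fun x t : ℝ => t * (x ^ 2 + t)⁻¹)
      (Set.Ioi 0 ×ˢ spectrum ℝ A) := by
    refine ContinuousOn.mul (by fun_prop) (ContinuousOn.inv₀ (by fun_prop) ?_)
    rintro ⟨x, t⟩ ⟨-, ht⟩
    exact hne x t ht
  have hfin := (aux_integrable ‖A‖ δ hδ).integrableOn (s := Set.Ioi 0) |>.hasFiniteIntegral
  have hA0 : 0 ≤ A := by
    rw [← cfc_id' ℝ A]
    exact cfc_nonneg fun t ht => (hpos t ht).le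
  simp_rw [hf]
  refine ⟨fun x => ?_, ?_, fun x => ?_, ?_⟩
  · rw [← hadd]
    exact (isUnit_cfc_iff (fun t : ℝ => x ^ 2 + t) A).mpr (hne x)
  · exact integrableOn_cfc measurableSet_Ioi _ _ A hcont (ae_of_all _ hbd) hfin hA
  · exact norm_cfc_le (by positivity) (hbd x)
  · rw [← cfc_setIntegral measurableSet_Ioi _ _ A hcont (ae_of_all _ hbd) hfin hA,
      cfc_congr (fun t ht => aux_integral t (hpos t ht)),
      cfc_const_mul (Real.pi / 2) Real.sqrt A, smul_smul, CFC.sqrt_eq_real_sqrt A hA0,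
      cfcₙ_eq_cfc]
    have : 2 / Real.pi * (Real.pi / 2) = 1 := by
      field_simp
    rw [this, one_smul]
end

section
/- For every n ∈ ℕ and all real constants ε* > 0, M ≥ 0, K ≥ 0, E ≥ 0 there exist constants A ≥ 0 and B ≥ 0 such that the following holds: for all self-adjoint H₀, H₁ ∈ B(𝓗) with spectrum of H₀ contained in [1,∞) and ‖H₁·(√H₀)⁻¹‖ ≤ K, for every ε ∈ (0,ε*] and every c ∈ ℝ with |c| ≤ ε·M such that H := H₀ + c·H₁ has spectrum contained in [1,∞) and such that ‖(√H)^k · (H₁H₀ − H₀H₁) · ((√H)⁻¹)^{k+2}‖ ≤ E for every natural number k with k ≤ n − 2, one has ‖(√H₀)^n · ((√H)⁻¹)^n‖ ≤ 1 + A·ε and ‖(√H)^n · ((√H₀)⁻¹)^n‖ ≤ 1 + B·ε. -/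
/-- data of a square root bounded below by one, together with its inverse -/
structure SqData {R : Type*} [NormedRing R] [NormedAlgebra ℝ R] (H S T : R) : Prop where
  sq : S * S = H
  st : S * T = 1
  ts : T * S = 1
  om : ∃ ω : ℝ, 0 < ω ∧ ‖ω • (1 : R) - S‖ ≤ ω - 1

section alg
variable {R : Type*} [NormedRing R] [NormedAlgebra ℝ R]

lemma SqData.norm_T {H S T : R} (h : SqData H S T) (h1 : ‖(1 : R)‖ ≤ 1) : ‖T‖ ≤ 1 := by
  obtain ⟨ω, hω, hS⟩ := h.om
  have e : ω • T = 1 + (ω • (1 : R) - S) * T := by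
    rw [sub_mul, smul_mul_assoc, one_mul, h.st]; abel
  have := norm_add_le (1 : R) ((ω • (1 : R) - S) * T)
  rw [← e, norm_smul, Real.norm_of_nonneg hω.le] at this
  have h2 := norm_mul_le (ω • (1 : R) - S) T
  have h3 := mul_le_mul_of_nonneg_right hS (norm_nonneg T)
  nlinarith

lemma SqData.sylv {H S T : R} (h : SqData H S T) (Z : R) :
    2 * ‖Z‖ ≤ ‖S * Z + Z * S‖ := by
  obtain ⟨ω, hω, hS⟩ := h.om
  have e : (2 * ω) • Z = (S * Z + Z * S) + ((ω • (1 : R) - S) * Z + Z * (ω • (1 : R) - S)) := by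
    rw [sub_mul, mul_sub, smul_mul_assoc, mul_smul_comm, one_mul, mul_one, mul_smul, two_smul]
    abel
  have h0 := norm_add₃_le (a := S * Z + Z * S) (b := (ω • (1 : R) - S) * Z)
    (c := Z * (ω • (1 : R) - S))
  rw [add_assoc, ← e, norm_smul, Real.norm_of_nonneg (by positivity)] at h0
  have h2 := norm_mul_le (ω • (1 : R) - S) Z
  have h2' := norm_mul_le Z (ω • (1 : R) - S)
  have h3 := mul_le_mul_of_nonneg_right hS (norm_nonneg Z)
  nlinarith

lemma SqData.mulT {H S T : R} (h : SqData H S T) (h1 : ‖(1 : R)‖ ≤ 1) (X : R) :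
    ‖X * T‖ ≤ ‖X‖ :=
  (norm_mul_le _ _).trans (mul_le_of_le_one_right (norm_nonneg _) (h.norm_T h1))

lemma SqData.cancel {H S T : R} (h : SqData H S T) (n : ℕ) : T ^ n * S ^ n = 1 := by
  have hc : Commute T S := by rw [Commute, SemiconjBy, h.ts, h.st]
  rw [← hc.mul_pow, h.ts, one_pow]

lemma SqData.comm {H S T D H₁ : R} (h : SqData H S T) (h1 : ‖(1 : R)‖ ≤ 1)
    (hD : D = H₁ * H - H * H₁) {K E : ℝ} (hK : ‖H₁ * T‖ ≤ K) :
    ∀ n : ℕ, (∀ k, k + 1 ≤ n → ‖S ^ k * D * T ^ (k + 2)‖ ≤ E) →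
      ‖S ^ n * H₁ * T ^ (n + 1)‖ ≤ K + n * E := by
  intro n
  induction n using Nat.twoStepInduction with
  | zero => intro _; simpa using hK
  | one =>
    intro hE
    have hE0 := hE 0 le_rfl
    have e : S * H₁ * T ^ 2 = H₁ * T - (H₁ * S - S * H₁) * T ^ 2 := by
      have : H₁ * S * T ^ 2 = H₁ * T := by
        rw [pow_two, mul_assoc, ← mul_assoc S, h.st, one_mul]
      rw [sub_mul, this]; abel
    have hs := h.sylv ((H₁ * S - S * H₁) * T ^ 2)
    have e2 : S * ((H₁ * S - S * H₁) * T ^ 2) + ((H₁ * S - S * H₁) * T ^ 2) * S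
        = D * T ^ 2 := by
      have : T ^ 2 * S = S * T ^ 2 := by
        rw [pow_two, mul_assoc, h.ts, ← mul_assoc, h.st, one_mul, mul_one]
      rw [mul_assoc _ (T ^ 2), this, hD, ← h.sq]; noncomm_ring
    rw [e2] at hs
    simp only [pow_zero, one_mul, zero_add] at hE0
    have := norm_sub_le (H₁ * T) ((H₁ * S - S * H₁) * T ^ 2)
    rw [← e] at this
    have := norm_nonneg (D * T ^ 2)
    norm_num
    linarith
  | more n ih _ =>
    intro hE
    have i := ih (fun k hk => hE k (by omega))
    have hEn := hE n (by omega)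
    have e : S ^ (n + 2) * H₁ * T ^ (n + 2 + 1)
        = S ^ n * H₁ * T ^ (n + 1) - S ^ n * D * T ^ (n + 2) * T := by
      have h2 : H * T ^ (n + 3) = T ^ (n + 1) := by
        rw [← h.sq, show n + 3 = 1 + (1 + (n + 1)) by ring, pow_add, pow_add T 1, pow_one,
          mul_assoc, ← mul_assoc S T, h.st, one_mul, ← mul_assoc, h.st, one_mul]
      have h3 : S ^ (n + 2) = S ^ n * H := by rw [pow_add, pow_two, h.sq]
      have h4 : H * H₁ = H₁ * H - D := by rw [hD]; abel
      rw [h3, mul_assoc (S ^ n), h4, mul_sub, sub_mul, mul_assoc _ (T ^ (n + 2)) T, ← pow_succ,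
        ← mul_assoc (S ^ n), mul_assoc _ H, h2]
    have h5 := norm_sub_le (S ^ n * H₁ * T ^ (n + 1)) (S ^ n * D * T ^ (n + 2) * T)
    rw [← e] at h5
    have h6 := h.mulT h1 (S ^ n * D * T ^ (n + 2))
    have := norm_nonneg (S ^ n * D * T ^ (n + 2))
    push_cast
    linarith

lemma step_b {H H₀ H₁ S T S₀ T₀ : R} (h : SqData H S T) (h0 : SqData H₀ S₀ T₀)
    (h1 : ‖(1 : R)‖ ≤ 1) {c C : ℝ} (hH : H = H₀ + c • H₁) (n : ℕ)
    (hC : ‖S ^ n * H₁ * T ^ (n + 1)‖ ≤ C) :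
    ‖S ^ (n + 2) * T₀ ^ (n + 2)‖ ≤
      ‖S ^ n * T₀ ^ n‖ + |c| * (C * ‖S ^ (n + 1) * T₀ ^ (n + 1)‖) := by
  have h2 : H₀ * T₀ ^ (n + 2) = T₀ ^ n := by
    rw [← h0.sq, show n + 2 = 1 + (1 + n) by ring, pow_add, pow_add T₀ 1, pow_one,
      mul_assoc, ← mul_assoc S₀ T₀, h0.st, one_mul, ← mul_assoc, h0.st, one_mul]
  have e : S ^ (n + 2) * T₀ ^ (n + 2) = S ^ n * T₀ ^ n +
      c • ((S ^ n * H₁ * T ^ (n + 1)) * (S ^ (n + 1) * T₀ ^ (n + 1)) * T₀) := by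
    have h3 : S ^ (n + 2) = S ^ n * H := by rw [pow_add, pow_two, h.sq]
    have h4 : (S ^ n * H₁ * T ^ (n + 1)) * (S ^ (n + 1) * T₀ ^ (n + 1)) * T₀
        = S ^ n * H₁ * T₀ ^ (n + 2) := by
      rw [mul_assoc, mul_assoc (S ^ (n + 1)), ← pow_succ, mul_assoc _ (T ^ (n + 1)),
        ← mul_assoc (T ^ (n + 1)), h.cancel, one_mul]
    rw [h4, h3, hH, mul_add, add_mul, mul_assoc _ H₀, h2, mul_smul_comm, smul_mul_assoc]
  rw [e]
  refine (norm_add_le _ _).trans ?_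
  rw [norm_smul, Real.norm_eq_abs]
  gcongr
  refine (h0.mulT h1 _).trans ((norm_mul_le _ _).trans ?_)
  gcongr

lemma step_a {H H₀ H₁ S T S₀ T₀ : R} (h : SqData H S T) (h0 : SqData H₀ S₀ T₀)
    (h1 : ‖(1 : R)‖ ≤ 1) {c C : ℝ} (hH : H = H₀ + c • H₁) (n : ℕ)
    (hC : ‖S ^ n * H₁ * T ^ (n + 1)‖ ≤ C) :
    ‖S₀ ^ (n + 2) * T ^ (n + 2)‖ ≤ ‖S₀ ^ n * T ^ n‖ * (1 + |c| * C) := by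
  have h2 : H * T ^ (n + 2) = T ^ n := by
    rw [← h.sq, show n + 2 = 1 + (1 + n) by ring, pow_add, pow_add T 1, pow_one,
      mul_assoc, ← mul_assoc S T, h.st, one_mul, ← mul_assoc, h.st, one_mul]
  have e : S₀ ^ (n + 2) * T ^ (n + 2) =
      (S₀ ^ n * T ^ n) * (1 - c • ((S ^ n * H₁ * T ^ (n + 1)) * T)) := by
    have h3 : S₀ ^ (n + 2) = S₀ ^ n * H₀ := by rw [pow_add, pow_two, h0.sq]
    have h5 : H₀ = H - c • H₁ := by rw [hH]; abel
    have h4 : (S₀ ^ n * T ^ n) * (S ^ n * H₁ * T ^ (n + 1) * T)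
        = S₀ ^ n * H₁ * T ^ (n + 2) := by
      rw [mul_assoc _ (T ^ (n + 1)), ← pow_succ, mul_assoc (S₀ ^ n), mul_assoc (S ^ n),
        ← mul_assoc (T ^ n), h.cancel, one_mul, mul_assoc]
    rw [mul_sub, mul_one, mul_smul_comm, h4, h3, h5, mul_sub, sub_mul, mul_assoc _ H, h2,
      mul_smul_comm, smul_mul_assoc]
  rw [e]
  refine (norm_mul_le _ _).trans ?_
  gcongr
  refine (norm_sub_le _ _).trans ?_
  rw [norm_smul, Real.norm_eq_abs]
  gcongr
  exact (h.mulT h1 _).trans hC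

variable [StarRing R] [CStarRing R] 

/-- the case `n = 1` -/
lemma one_a {H H₀ H₁ S T S₀ T₀ : R} (h : SqData H S T) (h0 : SqData H₀ S₀ T₀)
    (h1 : ‖(1 : R)‖ ≤ 1) {c K : ℝ} (hH : H = H₀ + c • H₁) (hK0 : 0 ≤ K)
    (hS0 : star S₀ = S₀) (hT : star T = T)
    (hK : ‖H₁ * T₀‖ ≤ K) : ‖S₀ * T‖ ≤ 1 + |c| * K := by
  have e : star (S₀ * T) * (S₀ * T) = 1 - c • (T * (H₁ * T₀) * (S₀ * T)) := by
    have h5 : H₀ = H - c • H₁ := by rw [hH]; abel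
    have h6 : T * H * T = 1 := by
      rw [← h.sq, ← mul_assoc, h.ts, one_mul, h.st]
    have h7 : T * (H₁ * T₀) * (S₀ * T) = T * H₁ * T := by
      rw [mul_assoc, mul_assoc H₁, ← mul_assoc T₀, h0.ts, one_mul, mul_assoc]
    rw [star_mul, hS0, hT, h7, mul_assoc, ← mul_assoc S₀, h0.sq, h5, sub_mul, mul_sub,
      ← mul_assoc, h6, smul_mul_assoc, mul_smul_comm, mul_assoc]
  have h2 : ‖S₀ * T‖ * ‖S₀ * T‖ ≤ 1 + |c| * (K * ‖S₀ * T‖) := by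
    rw [← CStarRing.norm_star_mul_self, e]
    refine (norm_sub_le _ _).trans ?_
    rw [norm_smul, Real.norm_eq_abs]
    gcongr
    refine (norm_mul_le _ _).trans ?_
    gcongr
    refine (norm_mul_le _ _).trans ?_
    nlinarith [h.norm_T h1, norm_nonneg T, norm_nonneg (H₁ * T₀)]
  have h3 : 0 ≤ |c| * K := by positivity
  by_contra hcon
  push Not at hcon
  nlinarith

lemma one_b {H H₀ H₁ S T S₀ T₀ : R} (h : SqData H S T) (h0 : SqData H₀ S₀ T₀)
    (h1 : ‖(1 : R)‖ ≤ 1) {c K : ℝ} (hH : H = H₀ + c • H₁) (hK0 : 0 ≤ K)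
    (hS : star S = S) (hT0 : star T₀ = T₀)
    (hK : ‖H₁ * T₀‖ ≤ K) : ‖S * T₀‖ ≤ 1 + |c| * K := by
  have e : star (S * T₀) * (S * T₀) = 1 + c • (T₀ * (H₁ * T₀)) := by
    have h6 : T₀ * (H₀ * T₀) = 1 := by
      rw [← h0.sq, mul_assoc, h0.st, mul_one, h0.ts]
    rw [star_mul, hS, hT0, mul_assoc, ← mul_assoc S, h.sq, hH, add_mul, mul_add,
      h6, smul_mul_assoc, mul_smul_comm]
  have h2 : ‖S * T₀‖ * ‖S * T₀‖ ≤ 1 + |c| * K := by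
    rw [← CStarRing.norm_star_mul_self, e]
    refine (norm_add_le _ _).trans ?_
    rw [norm_smul, Real.norm_eq_abs]
    gcongr
    refine (norm_mul_le _ _).trans ?_
    nlinarith [h0.norm_T h1, norm_nonneg T₀, norm_nonneg (H₁ * T₀)]
  have h3 : 0 ≤ |c| * K := by positivity
  by_contra hcon
  push Not at hcon
  nlinarith

end alg

lemma sqData_of_spectrum {V : Type*} [NormedAddCommGroup V] [InnerProductSpace ℂ V]
    [CompleteSpace V] (H : V →L[ℂ] V) (hH : IsSelfAdjoint H)
    (hs : spectrum ℝ H ⊆ Set.Ici 1) :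
    SqData H (CFC.sqrt H) (Ring.inverse (CFC.sqrt H)) ∧
      star (CFC.sqrt H) = CFC.sqrt H ∧
      star (Ring.inverse (CFC.sqrt H)) = Ring.inverse (CFC.sqrt H) := by
  have hpos : 0 ≤ H := by
    rw [StarOrderedRing.nonneg_iff_spectrum_nonneg (R := ℝ) H]
    intro x hx
    exact zero_le_one.trans (hs hx)
  have hsq : CFC.sqrt H * CFC.sqrt H = H := CFC.sqrt_mul_sqrt_self H hpos
  have hHu : IsUnit H := by
    rw [← spectrum.zero_notMem_iff ℝ]
    intro h
    have := hs h
    simp at this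
    linarith
  have hSu : IsUnit (CFC.sqrt H) := by
    rw [← hsq] at hHu
    exact (Commute.refl _).isUnit_mul_iff.mp hHu |>.1
  have hSsa : star (CFC.sqrt H) = CFC.sqrt H := (CFC.sqrt_nonneg H).isSelfAdjoint
  refine ⟨⟨hsq, Ring.mul_inverse_cancel _ hSu, Ring.inverse_mul_cancel _ hSu, ?_⟩, hSsa, ?_⟩
  · refine ⟨1 + √‖H‖, by positivity, ?_⟩
    have e : (1 + √‖H‖) • (1 : V →L[ℂ] V) - CFC.sqrt H
        = cfc (fun x : ℝ => (1 + √‖H‖) - √x) H := by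
      rw [cfc_sub (R := ℝ) (fun _ => 1 + √‖H‖) (fun x => √x) H, cfc_const (R := ℝ) _ H,
        CFC.sqrt_eq_real_sqrt H hpos, cfcₙ_eq_cfc, Algebra.algebraMap_eq_smul_one]
    rw [e]
    refine norm_cfc_le (by simp) ?_
    intro x hx
    have hx1 : 1 ≤ √x := by rw [Real.one_le_sqrt]; exact hs hx
    have hx2 : √x ≤ √‖H‖ := by
      apply Real.sqrt_le_sqrt
      have := spectrum.norm_le_norm_mul_of_mem hx
      have h1 : ‖(1 : V →L[ℂ] V)‖ ≤ 1 := ContinuousLinearMap.norm_id_le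
      rw [Real.norm_eq_abs] at this
      nlinarith [le_abs_self x, norm_nonneg H]
    rw [Real.norm_eq_abs, abs_of_nonneg (by linarith)]
    linarith
  · rw [← Ring.inverse_star, hSsa]

variable {𝓗 : Type*} [NormedAddCommGroup 𝓗] [InnerProductSpace ℂ 𝓗] [CompleteSpace 𝓗]

theorem stmt_12 (n : ℕ) (εstar M K E : ℝ) (hεstar : 0 < εstar) (hM : 0 ≤ M)
    (hK : 0 ≤ K) (hE : 0 ≤ E) :
    ∃ A B : ℝ, 0 ≤ A ∧ 0 ≤ B ∧
      ∀ (H₀ H₁ : 𝓗 →L[ℂ] 𝓗), IsSelfAdjoint H₀ → IsSelfAdjoint H₁ →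
        spectrum ℝ H₀ ⊆ Set.Ici 1 → ‖H₁ * Ring.inverse (CFC.sqrt H₀)‖ ≤ K →
        ∀ ε ∈ Set.Ioc 0 εstar, ∀ c : ℝ, |c| ≤ ε * M →
        ∀ H : 𝓗 →L[ℂ] 𝓗, H = H₀ + c • H₁ →
        spectrum ℝ H ⊆ Set.Ici 1 →
        (∀ k : ℕ, k + 2 ≤ n →
          ‖(CFC.sqrt H) ^ k * (H₁ * H₀ - H₀ * H₁) *
            (Ring.inverse (CFC.sqrt H)) ^ (k + 2)‖ ≤ E) →
        ‖(CFC.sqrt H₀) ^ n * (Ring.inverse (CFC.sqrt H)) ^ n‖ ≤ 1 + A * ε ∧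
        ‖(CFC.sqrt H) ^ n * (Ring.inverse (CFC.sqrt H₀)) ^ n‖ ≤ 1 + B * ε := by
  have h1 : ‖(1 : 𝓗 →L[ℂ] 𝓗)‖ ≤ 1 := ContinuousLinearMap.norm_id_le
  induction n using Nat.twoStepInduction with
  | zero =>
    refine ⟨0, 0, le_rfl, le_rfl, ?_⟩
    intros
    simpa using h1
  | one =>
    refine ⟨M * K, M * K, by positivity, by positivity, ?_⟩
    intro H₀ H₁ sa0 sa1 sp0 hK1 ε hε c hc H hH sp _
    have sa : IsSelfAdjoint H := by
      rw [hH]; exact sa0.add ((IsSelfAdjoint.all c).smul sa1)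
    obtain ⟨h0, hS0, hT0⟩ := sqData_of_spectrum H₀ sa0 sp0
    obtain ⟨h, hS, hT⟩ := sqData_of_spectrum H sa sp
    have a := one_a h h0 h1 hH hK hS0 hT hK1
    have b := one_b h h0 h1 hH hK hS hT0 hK1
    have := mul_le_mul_of_nonneg_right hc hK
    simp only [pow_one]
    constructor <;> nlinarith
  | more n ih ih' =>
    obtain ⟨A, B, hA, hB, ih⟩ := ih
    obtain ⟨A', B', hA', hB', ih'⟩ := ih'
    set C : ℝ := K * (1 + εstar * M * K) + n * E with hCdef
    have hC0 : 0 ≤ C := by positivity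
    refine ⟨A + M * C + A * εstar * M * C, B + M * C * (1 + B' * εstar),
      by positivity, by positivity, ?_⟩
    intro H₀ H₁ sa0 sa1 sp0 hK1 ε hε c hc H hH sp hcomm
    have sa : IsSelfAdjoint H := by
      rw [hH]; exact sa0.add ((IsSelfAdjoint.all c).smul sa1)
    obtain ⟨i1, i2⟩ := ih H₀ H₁ sa0 sa1 sp0 hK1 ε hε c hc H hH sp
      (fun k hk => hcomm k (by omega))
    obtain ⟨_, i3⟩ := ih' H₀ H₁ sa0 sa1 sp0 hK1 ε hε c hc H hH sp
      (fun k hk => hcomm k (by omega))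
    obtain ⟨h0, hS0, hT0⟩ := sqData_of_spectrum H₀ sa0 sp0
    obtain ⟨h, hS, hT⟩ := sqData_of_spectrum H sa sp
    have a := one_a h h0 h1 hH hK hS0 hT hK1
    obtain ⟨hε0, hε1⟩ := hε
    generalize CFC.sqrt H = S at *
    generalize CFC.sqrt H₀ = S₀ at *
    generalize Ring.inverse S = T at *
    generalize Ring.inverse S₀ = T₀ at *
    have hD : H₁ * H₀ - H₀ * H₁ = H₁ * H - H * H₁ := by
      rw [hH, mul_add, add_mul, mul_smul_comm, smul_mul_assoc]; abel
    have hcs : |c| ≤ εstar * M := hc.trans (by gcongr)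
    have hK2 : ‖H₁ * T‖ ≤ K * (1 + εstar * M * K) := by
      have e : H₁ * T = (H₁ * T₀) * (S₀ * T) := by
        rw [mul_assoc, ← mul_assoc T₀, h0.ts, one_mul]
      rw [e]
      refine (norm_mul_le _ _).trans ?_
      gcongr
      exact a.trans (by gcongr)
    have hC : ‖S ^ n * H₁ * T ^ (n + 1)‖ ≤ C :=
      h.comm h1 hD hK2 n (fun k hk => hcomm k (by omega))
    constructor
    · refine (step_a h h0 h1 hH n hC).trans ?_
      calc _ ≤ (1 + A * ε) * (1 + (ε * M) * C) := by gcongr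
        _ = 1 + (A + M * C + A * ε * M * C) * ε := by ring
        _ ≤ _ := by gcongr
    · refine (step_b h h0 h1 hH n hC).trans ?_
      calc _ ≤ (1 + B * ε) + (ε * M) * (C * (1 + B' * ε)) := by gcongr
        _ = 1 + (B + M * C * (1 + B' * ε)) * ε := by ring
        _ ≤ _ := by gcongr
end

section
/- For every n ∈ ℕ and all real constants ε* > 0, M ≥ 0, M′ ≥ 0, K ≥ 0, E ≥ 0 there exists a constant C ≥ 0 such that the following holds. Let H₀, H₁ ∈ B(𝓗) be self-adjoint with spectrum of H₀ contained in [1,∞) and ‖H₁·(√H₀)⁻¹‖ ≤ K; let g be a switching function with max_{[0,1]}|g| ≤ M and max_{[0,1]}|g′| ≤ M′; let ε ∈ (0,ε*] and η > 0; set H(t) := H₀ + ε·g(η·t)·H₁ and assume that for every t ∈ ℝ the spectrum of H(t) is contained in [1,∞) and that for every integer j with 1 ≤ j ≤ n one has ‖((√H(t))⁻¹)^j · (H₁H₀ − H₀H₁) · T_{j−2}(t)‖ ≤ E, where T_m(t) := (√H(t))^m if m ≥ 0 and T_m(t) := ((√H(t))⁻¹)^{−m} if m < 0. Then for every unitary propagator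 U for the family t ↦ H(t) and all t, r ∈ ℝ: ‖((√H(t))⁻¹)^n · U(t,r) · (√H(r))^n‖ ≤ C and ‖(√H(t))^n · U(t,r) · ((√H(r))⁻¹)^n‖ ≤ C; in particular the bound is uniform in η > 0 and in t, r ∈ ℝ. -/
open MeasureTheory
set_option synthInstance.maxHeartbeats 1000000
set_option maxHeartbeats 1000000

variable {𝓗 : Type*} [NormedAddCommGroup 𝓗] [InnerProductSpace ℂ 𝓗] [CompleteSpace 𝓗]

/-- `opZPow A m` is `A^m` for `m ≥ 0` and `(Ring.inverse A)^(−m)` for `m < 0`. -/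
noncomputable def opZPow (A : 𝓗 →L[ℂ] 𝓗) (m : ℤ) : 𝓗 →L[ℂ] 𝓗 :=
  if 0 ≤ m then A ^ m.toNat else (Ring.inverse A) ^ (-m).toNat

/-- A unitary propagator for the family `t ↦ H t` of bounded self-adjoint operators:
every `U t r` is unitary, `U t t = 1`, `U t r * U r u = U t u`, and for each fixed `r`
the map `t ↦ U t r` is differentiable in operator norm with `i·(d/dt)U(t,r) = H(t)·U(t,r)`,
i.e. the derivative is `−i·(H(t)·U(t,r))`. -/
def IsUnitaryPropagator (H : ℝ → 𝓗 →L[ℂ] 𝓗) (U : ℝ → ℝ → 𝓗 →L[ℂ] 𝓗) : Prop :=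
  (∀ t r, U t r ∈ unitary (𝓗 →L[ℂ] 𝓗)) ∧ (∀ t, U t t = 1) ∧
  (∀ t r u, U t r * U r u = U t u) ∧
  (∀ r t, HasDerivAt (fun s => U s r) (-(Complex.I • (H t * U t r))) t)


namespace Stmt17

set_option linter.unusedSectionVars false

lemma norm_le_of_isUnit_one_le (T A : 𝓗 →L[ℂ] 𝓗) (hA : IsSelfAdjoint A) (hAA : A * A = T) (h1 : 1 ≤ T)
    (ψ : 𝓗) : ‖ψ‖ ≤ ‖A ψ‖ := by
  rw [ContinuousLinearMap.le_def] at h1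
  have h := h1.re_inner_nonneg_left ψ
  have h2 := ContinuousLinearMap.apply_norm_sq_eq_inner_adjoint_left A ψ
  rw [hA.adjoint_eq, show A ∘SL A = T from hAA] at h2
  have h3 : RCLike.re (inner ℂ ((T - 1) ψ) ψ) = ‖A ψ‖ ^ 2 - ‖ψ‖ ^ 2 := by
    rw [h2, sub_apply, inner_sub_left, map_sub,
      one_apply_eq_self, inner_self_eq_norm_sq]
  rw [h3] at h
  exact (sq_le_sq₀ (norm_nonneg _) (norm_nonneg _)).1 (by linarith)

lemma exists_unit (T : 𝓗 →L[ℂ] 𝓗) (hT : IsSelfAdjoint T) (hs : spectrum ℝ T ⊆ Set.Ici 1) :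
    ∃ u : (𝓗 →L[ℂ] 𝓗)ˣ, (u : 𝓗 →L[ℂ] 𝓗) = CFC.sqrt T ∧ IsSelfAdjoint (u : 𝓗 →L[ℂ] 𝓗) ∧
      (u : 𝓗 →L[ℂ] 𝓗) * u = T ∧ ∀ ψ, ‖ψ‖ ≤ ‖(u : 𝓗 →L[ℂ] 𝓗) ψ‖ := by
  have h1 : 1 ≤ T := (CFC.one_le_iff (R := ℝ) T hT).2 fun x hx => hs hx
  have h0 : 0 ≤ T := (StarOrderedRing.nonneg_iff_spectrum_nonneg (R := ℝ) T hT).2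
    fun x hx => zero_le_one.trans (hs hx)
  have hu : IsUnit T := (spectrum.zero_notMem_iff ℝ).1 fun h => by
    have := hs h
    simp at this
    linarith
  have hsq := CFC.sqrt_mul_sqrt_self T h0
  have hsa : IsSelfAdjoint (CFC.sqrt T) := IsSelfAdjoint.of_nonneg (CFC.sqrt_nonneg T)
  have hA : IsUnit (CFC.sqrt T) := by
    rw [← isUnit_pow_iff two_ne_zero, pow_two, hsq]; exact hu
  obtain ⟨u, hu⟩ := hA
  refine ⟨u, hu, hu ▸ hsa, by rw [hu, hsq], ?_⟩
  rw [hu]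
  exact norm_le_of_isUnit_one_le T _ hsa hsq h1

lemma norm_mul_inv_le (u : (𝓗 →L[ℂ] 𝓗)ˣ) (B : 𝓗 →L[ℂ] 𝓗) (c : ℝ) (hc : 0 ≤ c)
    (h : ∀ ψ, ‖B ψ‖ ≤ c * ‖(u : 𝓗 →L[ℂ] 𝓗) ψ‖) :
    ‖B * ((u⁻¹ : (𝓗 →L[ℂ] 𝓗)ˣ) : 𝓗 →L[ℂ] 𝓗)‖ ≤ c := by
  refine ContinuousLinearMap.opNorm_le_bound _ hc fun ψ => ?_
  have := h (((u⁻¹ : (𝓗 →L[ℂ] 𝓗)ˣ) : 𝓗 →L[ℂ] 𝓗) ψ)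
  rwa [← mul_apply_eq_comp, ← mul_apply_eq_comp, Units.mul_inv,
    one_apply_eq_self] at this

lemma le_mul_norm (u : (𝓗 →L[ℂ] 𝓗)ˣ) (B : 𝓗 →L[ℂ] 𝓗) (c : ℝ)
    (h : ‖B * ((u⁻¹ : (𝓗 →L[ℂ] 𝓗)ˣ) : 𝓗 →L[ℂ] 𝓗)‖ ≤ c) (ψ : 𝓗) :
    ‖B ψ‖ ≤ c * ‖(u : 𝓗 →L[ℂ] 𝓗) ψ‖ := by
  have h2 := ContinuousLinearMap.le_of_opNorm_le _ h ((u : 𝓗 →L[ℂ] 𝓗) ψ)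
  rwa [← mul_apply_eq_comp, mul_assoc, Units.inv_mul, mul_one] at h2

lemma H1_bound (u₀ u : (𝓗 →L[ℂ] 𝓗)ˣ) (H₁ : 𝓗 →L[ℂ] 𝓗) (c m K : ℝ) (hm : |c| ≤ m) (hK : 0 ≤ K)
    (h0 : IsSelfAdjoint (u₀ : 𝓗 →L[ℂ] 𝓗)) (h : IsSelfAdjoint (u : 𝓗 →L[ℂ] 𝓗))
    (hu : ∀ ψ, ‖ψ‖ ≤ ‖(u : 𝓗 →L[ℂ] 𝓗) ψ‖)
    (heq : (u : 𝓗 →L[ℂ] 𝓗) * u = u₀ * u₀ + c • H₁)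
    (hb : ‖H₁ * ((u₀⁻¹ : (𝓗 →L[ℂ] 𝓗)ˣ) : 𝓗 →L[ℂ] 𝓗)‖ ≤ K) :
    ‖H₁ * ((u⁻¹ : (𝓗 →L[ℂ] 𝓗)ˣ) : 𝓗 →L[ℂ] 𝓗)‖ ≤ K + K ^ 2 * m := by
  have hm0 : 0 ≤ m := (abs_nonneg c).trans hm
  refine norm_mul_inv_le u H₁ _ (by positivity) fun ψ => ?_
  have h1 := le_mul_norm u₀ H₁ K hb ψ
  have e0 := ContinuousLinearMap.apply_norm_sq_eq_inner_adjoint_left (u₀ : 𝓗 →L[ℂ] 𝓗) ψ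
  have e1 := ContinuousLinearMap.apply_norm_sq_eq_inner_adjoint_left (u : 𝓗 →L[ℂ] 𝓗) ψ
  rw [h0.adjoint_eq] at e0
  rw [h.adjoint_eq, show (u : 𝓗 →L[ℂ] 𝓗) ∘SL (u : 𝓗 →L[ℂ] 𝓗) = (u₀ : 𝓗 →L[ℂ] 𝓗) * u₀ + c • H₁ from heq,
    add_apply, inner_add_left, map_add] at e1
  have e2 : RCLike.re (inner ℂ (((u₀ : 𝓗 →L[ℂ] 𝓗) * u₀) ψ) ψ) = ‖(u₀ : 𝓗 →L[ℂ] 𝓗) ψ‖ ^ 2 := e0.symm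
  rw [e2] at e1
  have e3 : ‖inner ℂ ((c • H₁) ψ) ψ‖ ≤ m * ‖H₁ ψ‖ * ‖(u : 𝓗 →L[ℂ] 𝓗) ψ‖ := by
    refine (norm_inner_le_norm _ _).trans ?_
    rw [smul_apply, norm_smul, Real.norm_eq_abs]
    gcongr
    exact hu ψ
  have e4 := (abs_le.1 (RCLike.abs_re_le_norm (inner ℂ ((c • H₁) ψ) ψ))).1
  set x := ‖H₁ ψ‖
  set y := ‖(u : 𝓗 →L[ℂ] 𝓗) ψ‖
  set z := ‖(u₀ : 𝓗 →L[ℂ] 𝓗) ψ‖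
  have hx : 0 ≤ x := norm_nonneg _
  have hy : 0 ≤ y := norm_nonneg _
  have hz : z ^ 2 ≤ y ^ 2 + m * x * y := by linarith
  have hxz : x ^ 2 ≤ K ^ 2 * z ^ 2 := by rw [← mul_pow]; gcongr
  have hfin : x ^ 2 ≤ K ^ 2 * (y ^ 2 + m * x * y) := hxz.trans (by gcongr)
  by_contra! hcon
  have a1 : 0 ≤ K * y := by positivity
  have a2 : 0 ≤ K ^ 2 * m * y := by positivity
  have a3 : K * y < x - K ^ 2 * m * y := by linarith
  have a4 : K * y < x := by linarith
  nlinarith [mul_lt_mul'' a3 a4 a1 a1]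

lemma commute_bound (n : ℕ) (u : (𝓗 →L[ℂ] 𝓗)ˣ) (H₁ : 𝓗 →L[ℂ] 𝓗) (K E : ℝ) (hE : 0 ≤ E)
    (h : IsSelfAdjoint (u : 𝓗 →L[ℂ] 𝓗)) (h1 : IsSelfAdjoint H₁)
    (hu : ‖((u⁻¹ : (𝓗 →L[ℂ] 𝓗)ˣ) : 𝓗 →L[ℂ] 𝓗)‖ ≤ 1)
    (hb : ‖H₁ * ((u⁻¹ : (𝓗 →L[ℂ] 𝓗)ˣ) : 𝓗 →L[ℂ] 𝓗)‖ ≤ K)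
    (hj : ∀ j : ℕ, 1 ≤ j → j ≤ n → ‖((u ^ (-(j : ℤ)) : (𝓗 →L[ℂ] 𝓗)ˣ) : 𝓗 →L[ℂ] 𝓗) *
      (H₁ * (u * u) - (u * u) * H₁) * ((u ^ ((j : ℤ) - 2) : (𝓗 →L[ℂ] 𝓗)ˣ) : 𝓗 →L[ℂ] 𝓗)‖ ≤ E) :
    ∀ q : ℕ, 1 ≤ q → q ≤ n → ‖((u ^ (-(q : ℤ)) : (𝓗 →L[ℂ] 𝓗)ˣ) : 𝓗 →L[ℂ] 𝓗) *
      H₁ * ((u ^ ((q : ℤ) - 2) : (𝓗 →L[ℂ] 𝓗)ˣ) : 𝓗 →L[ℂ] 𝓗)‖ ≤ K + q * E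
  | 0 => fun h => absurd h (by norm_num)
  | 1 => fun _ _ => by
    have : ((1 : ℕ) : ℤ) - 2 = -1 := by norm_num
    rw [this, Nat.cast_one, zpow_neg_one, mul_assoc]
    refine (norm_mul_le _ _).trans ?_
    have := mul_le_mul hu hb (norm_nonneg _) zero_le_one
    push_cast; linarith
  | 2 => fun _ _ => by
    have : ((2 : ℕ) : ℤ) - 2 = 0 := by norm_num
    rw [this, zpow_zero, Units.val_one, mul_one]
    have e : u ^ (-((2 : ℕ) : ℤ)) = u⁻¹ * u⁻¹ := by
      rw [zpow_neg, zpow_natCast, pow_two, mul_inv_rev]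
    have hi : star ((u⁻¹ : (𝓗 →L[ℂ] 𝓗)ˣ) : 𝓗 →L[ℂ] 𝓗) = ((u⁻¹ : (𝓗 →L[ℂ] 𝓗)ˣ) : 𝓗 →L[ℂ] 𝓗) := by
      rw [← Units.coe_star_inv]
      have : star u = u := Units.ext h
      rw [this]
    rw [e, Units.val_mul, mul_assoc]
    refine (norm_mul_le _ _).trans ?_
    have h3 : ‖((u⁻¹ : (𝓗 →L[ℂ] 𝓗)ˣ) : 𝓗 →L[ℂ] 𝓗) * H₁‖ ≤ K := by
      rw [← norm_star, star_mul, hi, h1.star_eq]; exact hb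
    have := mul_le_mul hu h3 (norm_nonneg _) zero_le_one
    push_cast; linarith
  | (q + 3) => fun _ hq => by
    have ih := commute_bound n u H₁ K E hE h h1 hu hb hj (q + 1) (by omega) (by omega)
    have hC := hj (q + 3) (by omega) hq
    have e1 : u ^ (((q + 3 : ℕ) : ℤ) - 2) = u * u * u ^ (((q + 1 : ℕ) : ℤ) - 2) := by
      rw [← pow_two, ← zpow_natCast, ← zpow_add]
      exact congrArg (u ^ ·) (by push_cast; ring)
    have e2 : u ^ (-((q + 1 : ℕ) : ℤ)) = u ^ (-((q + 3 : ℕ) : ℤ)) * (u * u) := by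
      rw [← pow_two, ← zpow_natCast, ← zpow_add]
      exact congrArg (u ^ ·) (by push_cast; ring)
    have e3 : u ^ (((q + 1 : ℕ) : ℤ) - 2) = u ^ (((q + 3 : ℕ) : ℤ) - 2) * (u⁻¹ * u⁻¹) := by
      rw [← pow_two, inv_pow, ← zpow_natCast, ← zpow_neg, ← zpow_add]
      exact congrArg (u ^ ·) (by push_cast; ring)
    have key : ((u ^ (-((q + 3 : ℕ) : ℤ)) : (𝓗 →L[ℂ] 𝓗)ˣ) : 𝓗 →L[ℂ] 𝓗) *
      H₁ * ((u ^ (((q + 3 : ℕ) : ℤ) - 2) : (𝓗 →L[ℂ] 𝓗)ˣ) : 𝓗 →L[ℂ] 𝓗) =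
      ((u ^ (-((q + 1 : ℕ) : ℤ)) : (𝓗 →L[ℂ] 𝓗)ˣ) : 𝓗 →L[ℂ] 𝓗) *
      H₁ * ((u ^ (((q + 1 : ℕ) : ℤ) - 2) : (𝓗 →L[ℂ] 𝓗)ˣ) : 𝓗 →L[ℂ] 𝓗) +
      (((u ^ (-((q + 3 : ℕ) : ℤ)) : (𝓗 →L[ℂ] 𝓗)ˣ) : 𝓗 →L[ℂ] 𝓗) *
      (H₁ * (u * u) - (u * u) * H₁) * ((u ^ (((q + 3 : ℕ) : ℤ) - 2) : (𝓗 →L[ℂ] 𝓗)ˣ) : 𝓗 →L[ℂ] 𝓗))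
        * (((u⁻¹ : (𝓗 →L[ℂ] 𝓗)ˣ) : 𝓗 →L[ℂ] 𝓗) * ((u⁻¹ : (𝓗 →L[ℂ] 𝓗)ˣ) : 𝓗 →L[ℂ] 𝓗)) := by
      have e3' := congrArg (Units.val) e3
      rw [Units.val_mul, Units.val_mul] at e3'
      rw [mul_assoc (_ * (H₁ * _ - _)), ← e3', e1, e2]
      simp only [Units.val_mul]
      noncomm_ring
    rw [key]
    refine (norm_add_le _ _).trans ?_
    have h4 := (norm_mul_le (((u ^ (-((q + 3 : ℕ) : ℤ)) : (𝓗 →L[ℂ] 𝓗)ˣ) : 𝓗 →L[ℂ] 𝓗) *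
      (H₁ * (u * u) - (u * u) * H₁) * ((u ^ (((q + 3 : ℕ) : ℤ) - 2) : (𝓗 →L[ℂ] 𝓗)ˣ) : 𝓗 →L[ℂ] 𝓗))
        (((u⁻¹ : (𝓗 →L[ℂ] 𝓗)ˣ) : 𝓗 →L[ℂ] 𝓗) * ((u⁻¹ : (𝓗 →L[ℂ] 𝓗)ˣ) : 𝓗 →L[ℂ] 𝓗)))
    have h5 := (norm_mul_le ((u⁻¹ : (𝓗 →L[ℂ] 𝓗)ˣ) : 𝓗 →L[ℂ] 𝓗) ((u⁻¹ : (𝓗 →L[ℂ] 𝓗)ˣ) : 𝓗 →L[ℂ] 𝓗)).trans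
      (mul_le_mul hu hu (norm_nonneg _) zero_le_one)
    have h6 := h4.trans (mul_le_mul hC h5 (norm_nonneg _) hE)
    push_cast at ih h6 ⊢
    linarith

lemma commute_bound2 (n : ℕ) (u : (𝓗 →L[ℂ] 𝓗)ˣ) (H₁ : 𝓗 →L[ℂ] 𝓗) (K E : ℝ) (hE : 0 ≤ E)
    (h : IsSelfAdjoint (u : 𝓗 →L[ℂ] 𝓗)) (h1 : IsSelfAdjoint H₁)
    (hq : ∀ q : ℕ, 1 ≤ q → q ≤ n → ‖((u ^ (-(q : ℤ)) : (𝓗 →L[ℂ] 𝓗)ˣ) : 𝓗 →L[ℂ] 𝓗) *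
      H₁ * ((u ^ ((q : ℤ) - 2) : (𝓗 →L[ℂ] 𝓗)ˣ) : 𝓗 →L[ℂ] 𝓗)‖ ≤ K + q * E)
    (p : ℤ) (hp1 : -n ≤ p) (hp2 : p + 2 ≤ n) :
    ‖((u ^ p : (𝓗 →L[ℂ] 𝓗)ˣ) : 𝓗 →L[ℂ] 𝓗) * H₁ *
      ((u ^ (-p - 2) : (𝓗 →L[ℂ] 𝓗)ˣ) : 𝓗 →L[ℂ] 𝓗)‖ ≤ K + n * E := by
  have hst : ∀ z : ℤ, star ((u ^ z : (𝓗 →L[ℂ] 𝓗)ˣ) : 𝓗 →L[ℂ] 𝓗) =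
      ((u ^ z : (𝓗 →L[ℂ] 𝓗)ˣ) : 𝓗 →L[ℂ] 𝓗) := fun z => by
    have : star u = u := Units.ext h
    rw [← Units.coe_star, star_zpow, this]
  have hle : ∀ q : ℕ, q ≤ n → K + q * E ≤ K + n * E := fun q hq => by gcongr
  rcases lt_or_ge p 0 with hp | hp
  · obtain ⟨q, rfl⟩ : ∃ q : ℕ, p = -(q : ℤ) := ⟨(-p).toNat, by omega⟩
    have := hq q (by omega) (by omega)
    rw [neg_neg]
    exact this.trans (hle q (by omega))
  · obtain ⟨q, hqp⟩ : ∃ q : ℕ, p = (q : ℤ) - 2 := ⟨(p + 2).toNat, by omega⟩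
    have := hq q (by omega) (by omega)
    rw [← norm_star, star_mul, star_mul, hst, hst, h1.star_eq, ← mul_assoc,
      show -p - 2 = -(q : ℤ) by omega, hqp]
    exact this.trans (hle q (by omega))

lemma pow_term (n i : ℕ) (hi : i < n) (u : (𝓗 →L[ℂ] 𝓗)ˣ) (H₁ : 𝓗 →L[ℂ] 𝓗) (L : ℝ)
    (h : IsSelfAdjoint (u : 𝓗 →L[ℂ] 𝓗))
    (hb : ∀ p : ℤ, -n ≤ p → p + 2 ≤ n → ‖((u ^ p : (𝓗 →L[ℂ] 𝓗)ˣ) : 𝓗 →L[ℂ] 𝓗) * H₁ *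
      ((u ^ (-p - 2) : (𝓗 →L[ℂ] 𝓗)ˣ) : 𝓗 →L[ℂ] 𝓗)‖ ≤ L) (V : 𝓗) :
    ‖inner ℂ V ((((u : 𝓗 →L[ℂ] 𝓗) * u) ^ (n.pred - i) * H₁ * ((u : 𝓗 →L[ℂ] 𝓗) * u) ^ i) V)‖ ≤
      L * ‖((u : 𝓗 →L[ℂ] 𝓗) ^ n) V‖ ^ 2 := by
  have hb' := hb (2 * ((n.pred - i : ℕ) : ℤ) - n) (by omega) (by rw [Nat.pred_eq_sub_one]; omega)
  set B := ((u ^ (2 * ((n.pred - i : ℕ) : ℤ) - n) : (𝓗 →L[ℂ] 𝓗)ˣ) : 𝓗 →L[ℂ] 𝓗) * H₁ *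
      ((u ^ (-(2 * ((n.pred - i : ℕ) : ℤ) - n) - 2) : (𝓗 →L[ℂ] 𝓗)ˣ) : 𝓗 →L[ℂ] 𝓗) with hB
  have e1 : ((u : 𝓗 →L[ℂ] 𝓗) * u) ^ (n.pred - i) =
      (u : 𝓗 →L[ℂ] 𝓗) ^ n * ((u ^ (2 * ((n.pred - i : ℕ) : ℤ) - n) : (𝓗 →L[ℂ] 𝓗)ˣ) : 𝓗 →L[ℂ] 𝓗) := by
    rw [← Units.val_pow_eq_pow_val, ← Units.val_mul, ← Units.val_mul, ← Units.val_pow_eq_pow_val]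
    congr 1
    rw [← pow_two, ← pow_mul, ← zpow_natCast, ← zpow_natCast, ← zpow_add]
    congr 1; push_cast; ring
  have e2 : ((u : 𝓗 →L[ℂ] 𝓗) * u) ^ i =
      ((u ^ (-(2 * ((n.pred - i : ℕ) : ℤ) - n) - 2) : (𝓗 →L[ℂ] 𝓗)ˣ) : 𝓗 →L[ℂ] 𝓗) *
        (u : 𝓗 →L[ℂ] 𝓗) ^ n := by
    rw [← Units.val_pow_eq_pow_val, ← Units.val_mul, ← Units.val_mul, ← Units.val_pow_eq_pow_val]
    congr 1
    rw [← pow_two, ← pow_mul, ← zpow_natCast, ← zpow_natCast, ← zpow_add]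
    congr 1; push_cast; rw [Nat.pred_eq_sub_one]; omega
  have e3 : ((u : 𝓗 →L[ℂ] 𝓗) * u) ^ (n.pred - i) * H₁ * ((u : 𝓗 →L[ℂ] 𝓗) * u) ^ i =
      (u : 𝓗 →L[ℂ] 𝓗) ^ n * (B * (u : 𝓗 →L[ℂ] 𝓗) ^ n) := by
    rw [e1, e2, hB]; simp only [mul_assoc]
  have e4 : ContinuousLinearMap.adjoint ((u : 𝓗 →L[ℂ] 𝓗) ^ n) = (u : 𝓗 →L[ℂ] 𝓗) ^ n :=
    (h.pow n).adjoint_eq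
  rw [e3, mul_apply_eq_comp, ← ContinuousLinearMap.adjoint_inner_left, e4]
  refine (norm_inner_le_norm _ _).trans ?_
  rw [mul_apply_eq_comp]
  have := ContinuousLinearMap.le_of_opNorm_le _ hb' (((u : 𝓗 →L[ℂ] 𝓗) ^ n) V)
  rw [pow_two]
  nlinarith [mul_le_mul_of_nonneg_left this (norm_nonneg (((u : 𝓗 →L[ℂ] 𝓗) ^ n) V))]

/-- derivative of the energy functional -/
lemma energy_deriv (n : ℕ) (H : ℝ → 𝓗 →L[ℂ] 𝓗) (V : ℝ → 𝓗 →L[ℂ] 𝓗) (H' : 𝓗 →L[ℂ] 𝓗) (t : ℝ)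
    (hsa : IsSelfAdjoint (H t)) (hH : HasDerivAt H H' t)
    (hV : HasDerivAt V (-(Complex.I • (H t * V t))) t) (φ : 𝓗) :
    HasDerivAt (fun s => RCLike.re (inner ℂ (V s φ) ((H s ^ n) (V s φ))))
      (RCLike.re (inner ℂ (V t φ)
        ((∑ i ∈ Finset.range n, H t ^ (n.pred - i) * H' * H t ^ i) (V t φ)))) t := by
  have hP := hH.fun_pow' n
  have hY := (hV.star.mul hP).mul hV
  have ha : HasDerivAt (fun s => (star (V s) * H s ^ n * V s) φ) _ t :=
    ((ContinuousLinearMap.apply ℂ 𝓗 φ).restrictScalars ℝ).hasFDerivAt.comp_hasDerivAt t hY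
  have hb := (hasDerivAt_const t φ).inner ℂ ha
  have hc := (RCLike.reCLM (K := ℂ)).hasFDerivAt.comp_hasDerivAt t hb
  have hfun : (fun s => RCLike.re (inner ℂ (V s φ) ((H s ^ n) (V s φ)))) =
      (RCLike.reCLM (K := ℂ)) ∘ fun t => inner ℂ φ ((star (V t) * H t ^ n * V t) φ) := by
    funext s
    simp [ContinuousLinearMap.star_eq_adjoint, ContinuousLinearMap.adjoint_inner_right]
  rw [hfun]
  refine hc.congr_deriv ?_
  set D := ∑ i ∈ Finset.range n, H t ^ (n.pred - i) * H' * H t ^ i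
  have hcomm : H t * H t ^ n = H t ^ n * H t := (pow_mul_comm' _ _).symm
  have hop : (star (-(Complex.I • (H t * V t))) * H t ^ n + star (V t) * D) * V t +
      star (V t) * H t ^ n * -(Complex.I • (H t * V t)) = star (V t) * D * V t := by
    simp only [star_neg, star_smul, star_mul, hsa.star_eq]
    have : star (V t) * H t * H t ^ n * V t = star (V t) * H t ^ n * (H t * V t) := by
      rw [mul_assoc (star (V t)), hcomm]; simp only [mul_assoc]
    simp [add_mul, this]
  have hop2 : (star (-(Complex.I • (H t * V t))) * H t ^ n + star (V t) * D) * V t +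
      ((fun x => star (V x)) * fun x => H x ^ n) t * -(Complex.I • (H t * V t)) =
        star (V t) * D * V t := hop
  rw [hop2, inner_zero_left, add_zero]
  simp [ContinuousLinearMap.star_eq_adjoint, ContinuousLinearMap.adjoint_inner_right]

lemma gronwall (f f' : ℝ → ℝ) (g : ℝ → ℝ) (L M' η : ℝ) (hL : 0 ≤ L) (hη : 0 < η)
    (hg : Continuous g) (hg0 : ∀ s ∉ Set.Ioo (0 : ℝ) 1, g s = 0)
    (hgM : ∀ s ∈ Set.Icc (0 : ℝ) 1, |g s| ≤ M')
    (hf : ∀ t, HasDerivAt f (f' t) t) (hf0 : ∀ t, 0 ≤ f t)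
    (hb : ∀ t, |f' t| ≤ L * (η * |g (η * t)|) * f t) (t r : ℝ) :
    f t ≤ Real.exp (L * M') * f r := by
  have hM' : 0 ≤ M' := (abs_nonneg _).trans (hgM 0 (by simp))
  set h : ℝ → ℝ := fun s => ∫ x in (0 : ℝ)..s, |g x| with hh
  have hd : ∀ s, HasDerivAt h (|g s|) s := fun s =>
    intervalIntegral.integral_hasDerivAt_right (hg.abs.intervalIntegrable _ _)
      (hg.abs.stronglyMeasurableAtFilter _ _) hg.abs.continuousAt
  have hG : ∀ t, HasDerivAt (fun t => h (η * t)) (η * |g (η * t)|) t := fun t => by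
    have := (hd (η * t)).comp t ((hasDerivAt_id t).const_mul η)
    simpa [mul_comm] using! this
  have hosc : ∀ a b, a ≤ b → h b - h a ≤ M' := fun a b hab => by
    have e : h b - h a = ∫ x in a..b, |g x| :=
      intervalIntegral.integral_interval_sub_left (hg.abs.intervalIntegrable _ _)
        (hg.abs.intervalIntegrable _ _)
    rw [e, intervalIntegral.integral_of_le hab]
    have e2 : ∫ x in Set.Ioc a b, |g x| = ∫ x in Set.Ioc a b ∩ Set.Ioo 0 1, |g x| := by
      refine MeasureTheory.setIntegral_eq_of_subset_of_forall_sdiff_eq_zero measurableSet_Ioc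
        Set.inter_subset_left fun x hx => ?_
      rw [hg0 x fun h => hx.2 ⟨hx.1, h⟩, abs_zero]
    rw [e2]
    have hv : volume (Set.Ioc a b ∩ Set.Ioo (0 : ℝ) 1) ≤ 1 :=
      (measure_mono Set.inter_subset_right).trans (by simp)
    have e3 := MeasureTheory.norm_setIntegral_le_of_norm_le_const (f := fun x => |g x|) (C := M')
      (hv.trans_lt ENNReal.one_lt_top) (fun x hx => by
        simpa using hgM x (Set.Ioo_subset_Icc_self hx.2))
    refine (le_abs_self _).trans (e3.trans ?_)
    have : volume.real (Set.Ioc a b ∩ Set.Ioo (0 : ℝ) 1) ≤ 1 :=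
      ENNReal.toReal_le_of_le_ofReal zero_le_one (by simpa using hv)
    nlinarith
  rcases le_total r t with hrt | htr
  · have hanti : Antitone fun t => f t * Real.exp (-(L * h (η * t))) := by
      have hD : ∀ t, HasDerivAt (fun t => f t * Real.exp (-(L * h (η * t)))) _ t := fun t =>
        (hf t).mul (((hG t).const_mul L).neg.exp)
      refine antitone_of_deriv_nonpos (fun t => (hD t).differentiableAt) fun t => ?_
      rw [(hD t).deriv]
      have := (abs_le.1 (hb t)).2
      change f' t * Real.exp (-(L * h (η * t))) +
        f t * (Real.exp (-(L * h (η * t))) * -(L * (η * |g (η * t)|))) ≤ 0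
      have hp := Real.exp_pos (-(L * h (η * t)))
      nlinarith
    have h1 := hanti hrt
    have h2 := hosc (η * r) (η * t) (by gcongr)
    have h3 : f t ≤ f r * Real.exp (L * (h (η * t) - h (η * r))) := by
      have := mul_le_mul_of_nonneg_right h1 (Real.exp_pos (L * h (η * t))).le
      simp only [mul_assoc, ← Real.exp_add] at this
      rw [neg_add_cancel, Real.exp_zero, mul_one] at this
      refine this.trans_eq ?_
      congr 2; ring
    rw [mul_comm]
    exact h3.trans (mul_le_mul_of_nonneg_left (Real.exp_le_exp.2 (by gcongr)) (hf0 r))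
  · have hmono : Monotone fun t => f t * Real.exp (L * h (η * t)) := by
      have hD : ∀ t, HasDerivAt (fun t => f t * Real.exp (L * h (η * t))) _ t := fun t =>
        (hf t).mul (((hG t).const_mul L).exp)
      refine monotone_of_deriv_nonneg (fun t => (hD t).differentiableAt) fun t => ?_
      rw [(hD t).deriv]
      have := (abs_le.1 (hb t)).1
      have hp := Real.exp_pos (L * h (η * t))
      nlinarith
    have h1 := hmono htr
    have h2 := hosc (η * t) (η * r) (by gcongr)
    have h3 : f t ≤ f r * Real.exp (L * (h (η * r) - h (η * t))) := by
      have := mul_le_mul_of_nonneg_right h1 (Real.exp_pos (-(L * h (η * t)))).le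
      simp only [mul_assoc, ← Real.exp_add] at this
      rw [add_neg_cancel, Real.exp_zero, mul_one] at this
      refine this.trans_eq ?_
      congr 2; ring
    rw [mul_comm]
    exact h3.trans (mul_le_mul_of_nonneg_left (Real.exp_le_exp.2 (by gcongr)) (hf0 r))

end Stmt17

/-- Energy estimates for the physical unitary propagator, uniformly in `η > 0` and
`t, r ∈ ℝ`: for every `n ∈ ℕ` and constants `ε* > 0`, `M, M′, K, E ≥ 0` there is `C ≥ 0`
such that, for all data as in the statement (self-adjoint `H₀, H₁` with
`spectrum H₀ ⊆ [1,∞)` and `‖H₁·(√H₀)⁻¹‖ ≤ K`; switching function `g` bounded by `M`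
with derivative bounded by `M′` on `[0,1]`; `ε ∈ (0,ε*]`, `η > 0`;
`H(t) := H₀ + ε·g(η·t)·H₁` with spectrum in `[1,∞)` and commutator bounds
`‖((√H(t))⁻¹)^j·[H₁,H₀]·T_{j−2}(t)‖ ≤ E` for all integers `1 ≤ j ≤ n`), every unitary
propagator `U` for `t ↦ H(t)` satisfies `‖((√H(t))⁻¹)^n·U(t,r)·(√H(r))^n‖ ≤ C` and
`‖(√H(t))^n·U(t,r)·((√H(r))⁻¹)^n‖ ≤ C` for all `t, r ∈ ℝ`. -/
theorem stmt_17 (n : ℕ) (εstar M M' K E : ℝ) (hεstar : 0 < εstar) (hM : 0 ≤ M)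
    (hM' : 0 ≤ M') (hK : 0 ≤ K) (hE : 0 ≤ E) :
    ∃ C : ℝ, 0 ≤ C ∧
      ∀ (H₀ H₁ : 𝓗 →L[ℂ] 𝓗), IsSelfAdjoint H₀ → IsSelfAdjoint H₁ →
        spectrum ℝ H₀ ⊆ Set.Ici 1 → ‖H₁ * Ring.inverse (CFC.sqrt H₀)‖ ≤ K →
        ∀ g : ℝ → ℝ, ContDiff ℝ 1 g → (∀ s ≤ (0 : ℝ), g s = 0) →
          (∀ s ∉ Set.Ioo (0 : ℝ) 1, deriv g s = 0) →
          (∀ s ∈ Set.Icc (0 : ℝ) 1, |g s| ≤ M) →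
          (∀ s ∈ Set.Icc (0 : ℝ) 1, |deriv g s| ≤ M') →
        ∀ ε ∈ Set.Ioc 0 εstar, ∀ η : ℝ, 0 < η →
        ∀ H : ℝ → 𝓗 →L[ℂ] 𝓗, (∀ t, H t = H₀ + (ε * g (η * t)) • H₁) →
        (∀ t, spectrum ℝ (H t) ⊆ Set.Ici 1) →
        (∀ t : ℝ, ∀ j : ℤ, 1 ≤ j → j ≤ (n : ℤ) →
          ‖(Ring.inverse (CFC.sqrt (H t))) ^ j.toNat * (H₁ * H₀ - H₀ * H₁) *
            opZPow (CFC.sqrt (H t)) (j - 2)‖ ≤ E) →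
        ∀ U : ℝ → ℝ → 𝓗 →L[ℂ] 𝓗, IsUnitaryPropagator H U →
        ∀ t r : ℝ,
          ‖(Ring.inverse (CFC.sqrt (H t))) ^ n * U t r * (CFC.sqrt (H r)) ^ n‖ ≤ C ∧
          ‖(CFC.sqrt (H t)) ^ n * U t r * (Ring.inverse (CFC.sqrt (H r))) ^ n‖ ≤ C := by
  have hexp : 1 ≤ Real.exp ((n * (εstar * ((K + K ^ 2 * (εstar * M)) + n * E))) * M') :=
    Real.one_le_exp (by positivity)
  refine ⟨Real.exp ((n * (εstar * ((K + K ^ 2 * (εstar * M)) + n * E))) * M'), by positivity, ?_⟩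
  intro H₀ H₁ h0 h1 hs0 hb g hg hg0 hg' hgM hgM' ε hε η hη H hH hsH hj U hU
  have hgM2 : ∀ s, |g s| ≤ M := fun s => by
    rcases le_total s 0 with h | h
    · rw [hg0 s h]; simpa using hM
    rcases le_total s 1 with h' | h'
    · exact hgM s ⟨h, h'⟩
    · have hc : g s = g 1 := by
        refine (convex_Ici (1 : ℝ)).is_const_of_fderivWithin_eq_zero (𝕜 := ℝ) (f := g)
          (hg.differentiable one_ne_zero).differentiableOn (fun x hx => ?_) h' (Set.self_mem_Ici)
        rw [((hg.differentiable one_ne_zero) x).fderivWithin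
          ((uniqueDiffOn_Ici (1 : ℝ)) x hx)]
        have h2 := hg' x (fun h => absurd h.2 (not_lt.2 hx))
        ext
        simpa using h2
      rw [hc]; exact hgM 1 (by simp)
  have hHsa : ∀ t, IsSelfAdjoint (H t) := fun t => by
    rw [hH t]; rw [isSelfAdjoint_iff, star_add, star_smul, h0.star_eq, h1.star_eq, star_trivial]
  obtain ⟨u₀, hu₀, hu₀sa, hu₀m, hu₀n⟩ := Stmt17.exists_unit H₀ h0 hs0
  choose u hu husa hum hun using fun t => Stmt17.exists_unit (H t) (hHsa t) (hsH t)
  have hKt : ∀ t, ‖H₁ * (((u t)⁻¹ : (𝓗 →L[ℂ] 𝓗)ˣ) : 𝓗 →L[ℂ] 𝓗)‖ ≤ K + K ^ 2 * (εstar * M) := fun t => by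
    refine Stmt17.H1_bound u₀ (u t) H₁ (ε * g (η * t)) (εstar * M) K ?_ hK hu₀sa (husa t) (hun t) ?_ ?_
    · rw [abs_mul, abs_of_pos hε.1]
      exact mul_le_mul hε.2 (hgM2 _) (abs_nonneg _) hεstar.le
    · rw [hum, hu₀m, hH]
    · rwa [← hu₀, Ring.inverse_unit] at hb
  have hinv : ∀ t, ‖(((u t)⁻¹ : (𝓗 →L[ℂ] 𝓗)ˣ) : 𝓗 →L[ℂ] 𝓗)‖ ≤ 1 := fun t => by
    have := Stmt17.norm_mul_inv_le (u t) 1 1 zero_le_one (fun ψ => by simpa using hun t ψ)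
    rwa [one_mul] at this
  have hcomm : ∀ t, H₁ * ((u t : 𝓗 →L[ℂ] 𝓗) * u t) - ((u t : 𝓗 →L[ℂ] 𝓗) * u t) * H₁ =
      H₁ * H₀ - H₀ * H₁ := fun t => by
    rw [hum, hH, mul_add, add_mul, mul_smul_comm, smul_mul_assoc]; abel
  have hjj : ∀ t, ∀ j : ℕ, 1 ≤ j → j ≤ n →
      ‖(((u t) ^ (-(j : ℤ)) : (𝓗 →L[ℂ] 𝓗)ˣ) : 𝓗 →L[ℂ] 𝓗) *
      (H₁ * ((u t : 𝓗 →L[ℂ] 𝓗) * u t) - ((u t : 𝓗 →L[ℂ] 𝓗) * u t) * H₁) *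
      (((u t) ^ ((j : ℤ) - 2) : (𝓗 →L[ℂ] 𝓗)ˣ) : 𝓗 →L[ℂ] 𝓗)‖ ≤ E := by
    intro t j hj1 hj2
    have := hj t j (by exact_mod_cast hj1) (by exact_mod_cast hj2)
    rw [hcomm]
    rw [← hu, Ring.inverse_unit, Int.toNat_natCast] at this
    have e1 : (((u t) ^ (-(j : ℤ)) : (𝓗 →L[ℂ] 𝓗)ˣ) : 𝓗 →L[ℂ] 𝓗) =
        (((u t)⁻¹ : (𝓗 →L[ℂ] 𝓗)ˣ) : 𝓗 →L[ℂ] 𝓗) ^ j := by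
      rw [zpow_neg, zpow_natCast, ← inv_pow, Units.val_pow_eq_pow_val]
    have e2 : (((u t) ^ ((j : ℤ) - 2) : (𝓗 →L[ℂ] 𝓗)ˣ) : 𝓗 →L[ℂ] 𝓗) =
        opZPow (u t : 𝓗 →L[ℂ] 𝓗) ((j : ℤ) - 2) := by
      unfold opZPow
      split_ifs with hc
      · rw [← Units.val_pow_eq_pow_val, ← zpow_natCast, Int.toNat_of_nonneg hc]
      · rw [Ring.inverse_unit, ← Units.val_pow_eq_pow_val, ← zpow_natCast,
          Int.toNat_of_nonneg (by omega), inv_zpow', neg_neg]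
    rw [e1, e2]
    exact this
  have hq := fun t => Stmt17.commute_bound n (u t) H₁ (K + K ^ 2 * (εstar * M)) E hE (husa t) h1
    (hinv t) (hKt t) (hjj t)
  have hp := fun t => Stmt17.commute_bound2 n (u t) H₁ (K + K ^ 2 * (εstar * M)) E hE (husa t) h1 (hq t)
  obtain ⟨hUu, hU1, hUm, hUd⟩ := hU
  have hHd : ∀ t, HasDerivAt H ((ε * (η * deriv g (η * t))) • H₁) t := fun t => by
    have e : H = fun t => H₀ + (ε * g (η * t)) • H₁ := funext hH
    have h2 : HasDerivAt (fun t => g (η * t)) (deriv g (η * t) * (η * 1)) t :=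
      ((hg.differentiable one_ne_zero) (η * t)).hasDerivAt.comp t ((hasDerivAt_id t).const_mul η)
    have h3 := ((h2.const_mul ε).smul_const H₁).const_add H₀
    rw [e]
    refine h3.congr_deriv ?_
    congr 1; ring
  have hfeq : ∀ t (V : 𝓗), RCLike.re (inner ℂ V ((H t ^ n) V)) = ‖((u t : 𝓗 →L[ℂ] 𝓗) ^ n) V‖ ^ 2 :=
    fun t V => by
      rw [ContinuousLinearMap.apply_norm_sq_eq_inner_adjoint_right, ((husa t).pow n).adjoint_eq]
      rw [← hum, ← pow_two, ← pow_mul, two_mul, pow_add]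
      rfl
  have hmain : ∀ r φ t, ‖((u t : 𝓗 →L[ℂ] 𝓗) ^ n) (U t r φ)‖ ^ 2 ≤
      Real.exp ((n * (εstar * ((K + K ^ 2 * (εstar * M)) + n * E))) * M') *
        ‖((u r : 𝓗 →L[ℂ] 𝓗) ^ n) φ‖ ^ 2 := fun r φ t => by
    have := Stmt17.gronwall (fun s => RCLike.re (inner ℂ (U s r φ) ((H s ^ n) (U s r φ)))) _
      (deriv g) (n * (εstar * ((K + K ^ 2 * (εstar * M)) + n * E))) M' η (by positivity) hη
      (hg.continuous_deriv le_rfl) hg' hgM'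
      (fun t => Stmt17.energy_deriv n H (fun s => U s r) _ t (hHsa t) (hHd t) (hUd r t) φ)
      (fun t => by rw [hfeq]; positivity) (fun t => ?_) t r
    · simp only [hfeq] at this
      rwa [hU1, one_apply_eq_self] at this
    · rw [hfeq]
      refine (RCLike.abs_re_le_norm _).trans ?_
      rw [sum_apply, inner_sum]
      refine (norm_sum_le _ _).trans ?_
      have hterm : ∀ i ∈ Finset.range n, ‖inner ℂ (U t r φ)
          ((H t ^ (n.pred - i) * ((ε * (η * deriv g (η * t))) • H₁) * H t ^ i) (U t r φ))‖ ≤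
          (εstar * (η * |deriv g (η * t)|)) * (((K + K ^ 2 * (εstar * M)) + n * E) *
            ‖((u t : 𝓗 →L[ℂ] 𝓗) ^ n) (U t r φ)‖ ^ 2) := fun i hi => by
        have h5 := Stmt17.pow_term n i (Finset.mem_range.1 hi) (u t) H₁ _ (husa t) (hp t) (U t r φ)
        rw [hum] at h5
        rw [mul_smul_comm, smul_mul_assoc, smul_apply, inner_smul_right_eq_smul, norm_smul,
          Real.norm_eq_abs, abs_mul, abs_mul, abs_of_pos hε.1, abs_of_pos hη]
        have hε2 := hε.2
        gcongr
      refine (Finset.sum_le_sum hterm).trans_eq ?_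
      rw [Finset.sum_const, Finset.card_range, nsmul_eq_mul]
      ring
  have hsecond : ∀ t r, ‖(CFC.sqrt (H t)) ^ n * U t r * (Ring.inverse (CFC.sqrt (H r))) ^ n‖ ≤
      Real.exp ((n * (εstar * ((K + K ^ 2 * (εstar * M)) + n * E))) * M') := fun t r => by
    rw [← hu, ← hu, Ring.inverse_unit]
    refine ContinuousLinearMap.opNorm_le_bound _ (by positivity) fun ψ => ?_
    have := hmain r (((((u r)⁻¹ : (𝓗 →L[ℂ] 𝓗)ˣ) : 𝓗 →L[ℂ] 𝓗) ^ n) ψ) t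
    have e : ((u r : 𝓗 →L[ℂ] 𝓗) ^ n) (((((u r)⁻¹ : (𝓗 →L[ℂ] 𝓗)ˣ) : 𝓗 →L[ℂ] 𝓗) ^ n) ψ) = ψ := by
      rw [← mul_apply_eq_comp, ← Units.val_pow_eq_pow_val, ← Units.val_pow_eq_pow_val, inv_pow,
        Units.mul_inv, one_apply_eq_self]
    rw [e] at this
    rw [mul_apply_eq_comp, mul_apply_eq_comp]
    refine (sq_le_sq₀ (norm_nonneg _) (by positivity)).1 (this.trans ?_)
    rw [mul_pow]
    gcongr
    exact le_self_pow₀ hexp two_ne_zero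
  intro t r
  refine ⟨?_, hsecond t r⟩
  have hUs : star (U t r) = U r t := by
    have h6 : star (U t r) * U t r = 1 := (Unitary.mem_iff.1 (hUu t r)).1
    calc star (U t r) = star (U t r) * (U t r * U r t) := by rw [hUm, hU1, mul_one]
      _ = U r t := by rw [← mul_assoc, h6, one_mul]
  have h7 := hsecond r t
  rw [← hu, ← hu, Ring.inverse_unit] at h7 ⊢
  rw [← norm_star]
  have hi : star (((u t)⁻¹ : (𝓗 →L[ℂ] 𝓗)ˣ) : 𝓗 →L[ℂ] 𝓗) = (((u t)⁻¹ : (𝓗 →L[ℂ] 𝓗)ˣ) : 𝓗 →L[ℂ] 𝓗) := by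
    have : star (u t) = u t := Units.ext (husa t)
    rw [← Units.coe_star_inv, this]
  rw [star_mul, star_mul, star_pow, star_pow, hi, (husa r).star_eq, hUs, ← mul_assoc]
  exact h7
end
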